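/- For every β > 0 and λ > 0, (1/t) · log ( (β/2) e^{β² t/2} ∫_{λt}^∞ Erfc((x - βt)/√(2t)) e^{-βx} dx ) → Δ_λ as t → ∞, where Δ_λ = β²/2 − βλ if λ < β and Δ_λ = −λ²/2 if λ ≥ β. -/

import Mathlib

open MeasureTheory Real Set Filter

/-- The complementary error function `Erfc`. -/
noncomputable def erfc (x : ℝ) : ℝ :=
  (2 / Real.sqrt Real.pi) * ∫ u in Set.Ioi x, Real.exp (-u ^ 2)

lemma gi : Integrable (fun u : ℝ => Real.exp (-u ^ 2)) := by
  simpa using integrable_exp_neg_mul_sq (b := 1) one_pos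

lemma gint : ∫ u : ℝ, Real.exp (-u ^ 2) = Real.sqrt Real.pi := by
  simpa using integral_gaussian 1

lemma spi : 0 < Real.sqrt Real.pi := Real.sqrt_pos.2 Real.pi_pos

lemma erfc_nonneg (x : ℝ) : 0 ≤ erfc x := by
  unfold erfc
  exact mul_nonneg (by positivity) (integral_nonneg fun u => (Real.exp_pos _).le)

lemma erfc_le_two (x : ℝ) : erfc x ≤ 2 := by
  unfold erfc
  have h : ∫ u in Set.Ioi x, Real.exp (-u ^ 2) ≤ Real.sqrt Real.pi := by
    rw [← gint]
    exact setIntegral_le_integral gi (Eventually.of_forall fun u => (Real.exp_pos _).le)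
  have := spi
  calc _ ≤ (2 / Real.sqrt Real.pi) * Real.sqrt Real.pi := by gcongr
    _ = 2 := by field_simp

lemma erfc_le_exp (y : ℝ) (hy : 0 ≤ y) : erfc y ≤ 2 * Real.exp (-y ^ 2) := by
  unfold erfc
  have gi' : Integrable (fun u : ℝ => Real.exp (-y ^ 2) * Real.exp (-(u - y) ^ 2)) :=
    (gi.comp_sub_right y).const_mul _
  have h : ∫ u in Set.Ioi y, Real.exp (-u ^ 2) ≤ Real.exp (-y ^ 2) * Real.sqrt Real.pi := by
    calc _ ≤ ∫ u in Set.Ioi y, Real.exp (-y ^ 2) * Real.exp (-(u - y) ^ 2) := by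
          refine setIntegral_mono_on gi.integrableOn gi'.integrableOn measurableSet_Ioi ?_
          intro u hu
          have hu : y < u := hu
          rw [← Real.exp_add]
          apply Real.exp_le_exp.2
          nlinarith
      _ ≤ ∫ u, Real.exp (-y ^ 2) * Real.exp (-(u - y) ^ 2) :=
          setIntegral_le_integral gi' (Eventually.of_forall fun u => by positivity)
      _ = _ := by
          rw [integral_const_mul, integral_sub_right_eq_self (fun u : ℝ => Real.exp (-u ^ 2)) y, gint]
  have := spi
  calc _ ≤ (2 / Real.sqrt Real.pi) * (Real.exp (-y ^ 2) * Real.sqrt Real.pi) := by gcongr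
    _ = _ := by field_simp

lemma erfc_anti : Antitone erfc := by
  intro x y hxy
  unfold erfc
  refine mul_le_mul_of_nonneg_left ?_ (by positivity)
  exact setIntegral_mono_set gi.integrableOn (Eventually.of_forall fun u => (Real.exp_pos _).le)
    (Set.Ioi_subset_Ioi hxy).eventuallyLE

lemma erfc_zero : erfc 0 = 1 := by
  unfold erfc
  have := integral_gaussian_Ioi 1
  simp at this
  rw [this]
  have := spi
  field_simp

lemma erfc_ge (y s : ℝ) (hy : 0 ≤ y) (hs : 0 < s) :
    (2 / Real.sqrt Real.pi) * (s * Real.exp (-(y + s) ^ 2)) ≤ erfc y := by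
  unfold erfc
  refine mul_le_mul_of_nonneg_left ?_ (by positivity)
  calc s * Real.exp (-(y + s) ^ 2) = ∫ u in Set.Ioc y (y+s), Real.exp (-(y + s) ^ 2) := by
        simp [hs.le]
    _ ≤ ∫ u in Set.Ioc y (y+s), Real.exp (-u ^ 2) := by
        refine setIntegral_mono_on (by simp) gi.integrableOn measurableSet_Ioc ?_
        intro u hu
        apply Real.exp_le_exp.2
        nlinarith [hu.1, hu.2]
    _ ≤ _ := setIntegral_mono_set gi.integrableOn
        (Eventually.of_forall fun u => (Real.exp_pos _).le)
        (Set.Ioc_subset_Ioi_self).eventuallyLE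

lemma integ (β c d a : ℝ) (hβ : 0 < β) :
    IntegrableOn (fun x => erfc ((x - c) / d) * Real.exp (-β * x)) (Set.Ioi a) := by
  have h := integrableOn_exp_mul_Ioi (a := -β) (by linarith) a
  refine Integrable.bdd_mul (c := 2) h ?_ ?_
  · have : Measurable erfc := erfc_anti.measurable
    exact (this.comp (by fun_prop : Measurable fun x : ℝ => (x - c) / d)).aestronglyMeasurable
  · refine Eventually.of_forall fun x => ?_
    rw [Real.norm_eq_abs, abs_of_nonneg (erfc_nonneg _)]
    exact erfc_le_two _

lemma upper1 (β c d a : ℝ) (hβ : 0 < β) :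
    ∫ x in Set.Ioi a, erfc ((x - c) / d) * Real.exp (-β * x) ≤ 2 * Real.exp (-β * a) / β := by
  have h := integrableOn_exp_mul_Ioi (a := -β) (by linarith) a
  calc _ ≤ ∫ x in Set.Ioi a, 2 * Real.exp (-β * x) := by
        refine setIntegral_mono_on (integ β c d a hβ) (h.const_mul 2) measurableSet_Ioi ?_
        intro x _
        exact mul_le_mul_of_nonneg_right (erfc_le_two _) (Real.exp_pos _).le
    _ = _ := by
        rw [integral_const_mul, integral_exp_mul_Ioi (by linarith)]
        field_simp

lemma upper2 (β l t : ℝ) (hβ : 0 < β) (hl : β ≤ l) (ht : 0 < t) :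
    ∫ x in Set.Ioi (l * t), erfc ((x - β * t) / Real.sqrt (2 * t)) * Real.exp (-β * x)
      ≤ 2 * Real.exp (-β ^ 2 * t / 2 - l ^ 2 * t / 2) / l := by
  have hl0 : 0 < l := by linarith
  have h := integrableOn_exp_mul_Ioi (a := -l) (by linarith) (l * t)
  calc _ ≤ ∫ x in Set.Ioi (l * t), 2 * Real.exp (-β ^ 2 * t / 2 + l ^ 2 * t / 2) * Real.exp (-l * x) := by
        refine setIntegral_mono_on (integ β _ _ _ hβ) (h.const_mul _) measurableSet_Ioi ?_
        intro x hx
        have hx : l * t < x := hx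
        have h1 : 0 ≤ x - β * t := by nlinarith
        have h2 := erfc_le_exp ((x - β * t) / Real.sqrt (2 * t)) (by positivity)
        rw [div_pow, Real.sq_sqrt (by positivity)] at h2
        calc _ ≤ 2 * Real.exp (-((x - β * t) ^ 2 / (2 * t))) * Real.exp (-β * x) := by gcongr
          _ ≤ _ := by
            rw [mul_assoc 2, mul_assoc 2, ← Real.exp_add, ← Real.exp_add]
            refine mul_le_mul_of_nonneg_left (Real.exp_le_exp.2 ?_) zero_le_two
            have : (x - β * t) ^ 2 / (2 * t) = (x - l * t) ^ 2 / (2 * t) + l * x - l ^ 2 * t / 2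
              - β * x + β ^ 2 * t / 2 := by field_simp; ring
            have h3 : 0 ≤ (x - l * t) ^ 2 / (2 * t) := by positivity
            rw [this]; nlinarith
    _ = _ := by
        rw [integral_const_mul, integral_exp_mul_Ioi (by linarith), neg_div_neg_eq, mul_div_assoc',
          mul_assoc, ← Real.exp_add]
        congr 3
        ring

lemma lower (β c d a m : ℝ) (hβ : 0 < β) (hm : 0 ≤ m)
    (h : m ≤ erfc ((a + 1 - c) / d)) (hd : 0 ≤ d) :
    m * Real.exp (-β * (a + 1)) ≤
      ∫ x in Set.Ioi a, erfc ((x - c) / d) * Real.exp (-β * x) := by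
  calc _ = ∫ x in Set.Ioc a (a+1), m * Real.exp (-β * (a + 1)) := by simp
    _ ≤ ∫ x in Set.Ioc a (a+1), erfc ((x - c) / d) * Real.exp (-β * x) := by
        refine setIntegral_mono_on (integrableOn_const (by simp))
          ((integ β c d a hβ).mono_set Set.Ioc_subset_Ioi_self) measurableSet_Ioc ?_
        intro x hx
        have h1 : erfc ((a + 1 - c) / d) ≤ erfc ((x - c) / d) := by
          apply erfc_anti
          have := hx.2
          gcongr
        apply mul_le_mul (h.trans h1) _ (Real.exp_pos _).le (erfc_nonneg _)
        apply Real.exp_le_exp.2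
        nlinarith [hx.2]
    _ ≤ _ := setIntegral_mono_set (integ β c d a hβ)
        (Eventually.of_forall fun u => mul_nonneg (erfc_nonneg _) (Real.exp_pos _).le)
        (Set.Ioc_subset_Ioi_self).eventuallyLE

lemma squeeze (F g : ℝ → ℝ) (Δ C : ℝ) (hg : Tendsto (fun t => (1 / t) * g t) atTop (nhds 0))
    (hlo : ∀ᶠ t in atTop, Real.exp (Δ * t + g t) ≤ F t)
    (hup : ∀ᶠ t in atTop, F t ≤ Real.exp (Δ * t + C)) :
    Tendsto (fun t : ℝ => (1 / t) * Real.log (F t)) atTop (nhds Δ) := by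
  have h1 : Tendsto (fun t => Δ + (1 / t) * g t) atTop (nhds Δ) := by
    simpa using hg.const_add Δ
  have h2 : Tendsto (fun t => Δ + (1 / t) * C) atTop (nhds Δ) := by
    have : Tendsto (fun t : ℝ => (1 / t) * C) atTop (nhds 0) := by
      simpa using tendsto_inv_atTop_zero.mul_const C
    simpa using this.const_add Δ
  refine tendsto_of_tendsto_of_tendsto_of_le_of_le' h1 h2 ?_ ?_
  · filter_upwards [hlo, eventually_gt_atTop 0] with t h ht
    have := Real.log_le_log (Real.exp_pos _) h
    rw [Real.log_exp] at this
    calc _ = (1 / t) * (Δ * t + g t) := by field_simp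
      _ ≤ _ := by gcongr
  · filter_upwards [hlo, hup, eventually_gt_atTop 0] with t h0 h ht
    have := Real.log_le_log ((Real.exp_pos _).trans_le h0) h
    rw [Real.log_exp] at this
    calc _ ≤ (1 / t) * (Δ * t + C) := by gcongr
      _ = _ := by field_simp

lemma tend (A B D : ℝ) :
    Tendsto (fun t : ℝ => (1 / t) * (A + B * t⁻¹ + D * Real.log t)) atTop (nhds 0) := by
  have h1 : Tendsto (fun t : ℝ => t⁻¹) atTop (nhds 0) := tendsto_inv_atTop_zero
  have h2 : Tendsto (fun t : ℝ => Real.log t / t) atTop (nhds 0) :=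
    Real.isLittleO_log_id_atTop.tendsto_div_nhds_zero
  have := ((h1.mul_const A).add ((h1.mul h1).const_mul B)).add (h2.const_mul D)
  simp only [zero_mul, mul_zero, add_zero] at this
  refine this.congr fun t => ?_
  ring

/-- For `β, λ > 0`, the second term in the explicit formula for `E|N_t^{λ t}|` has exponential
growth rate `Δ_λ`, where `Δ_λ = β²/2 - β λ` if `λ < β` and `Δ_λ = -λ²/2` if `λ ≥ β`. -/
theorem erfc_term_log_asymptotics (β l : ℝ) (hβ : 0 < β) (hl : 0 < l) :
    Tendsto (fun t : ℝ =>
        (1 / t) * Real.log ((β / 2) * Real.exp (β ^ 2 * t / 2) *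
          ∫ x in Set.Ioi (l * t),
            erfc ((x - β * t) / Real.sqrt (2 * t)) * Real.exp (-β * x)))
      atTop (nhds (if l < β then β ^ 2 / 2 - β * l else -l ^ 2 / 2)) := by
  have hpos : 0 < β / 2 := by linarith
  split_ifs with h
  · refine squeeze _ (fun t => (Real.log (β / 2) - β) + 0 * t⁻¹ + 0 * Real.log t) _ 0
      (tend _ _ _) ?_ ?_
    · filter_upwards [eventually_gt_atTop 0, eventually_ge_atTop (1 / (β - l))] with t ht ht2
      have h1 : l * t + 1 - β * t ≤ 0 := by
        rw [div_le_iff₀ (by linarith)] at ht2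
        nlinarith
      have h2 := lower β (β * t) (Real.sqrt (2 * t)) (l * t) 1 hβ zero_le_one
        (erfc_zero.symm.le.trans <| erfc_anti (div_nonpos_of_nonpos_of_nonneg h1 (by positivity)))
        (by positivity)
      calc _ = (β / 2) * Real.exp (β ^ 2 * t / 2) * (1 * Real.exp (-β * (l * t + 1))) := by
            nth_rewrite 2 [← Real.exp_log hpos]
            rw [one_mul, ← Real.exp_add, ← Real.exp_add]
            congr 1; ring
        _ ≤ _ := by gcongr
    · filter_upwards [eventually_gt_atTop 0] with t ht
      have h2 := upper1 β (β * t) (Real.sqrt (2 * t)) (l * t) hβ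
      calc _ ≤ (β / 2) * Real.exp (β ^ 2 * t / 2) * (2 * Real.exp (-β * (l * t)) / β) := by gcongr
        _ = Real.exp (β ^ 2 * t / 2) * Real.exp (-β * (l * t)) := by field_simp
        _ = _ := by rw [← Real.exp_add]; congr 1; ring
  · push Not at h
    have hq : 0 < β / Real.sqrt Real.pi / Real.sqrt 2 := by have := spi; positivity
    refine squeeze _ (fun t => (Real.log (β / Real.sqrt Real.pi / Real.sqrt 2) - β - 2 * (l - β))
      + (-2) * t⁻¹ + (-1 / 2) * Real.log t) _ (Real.log (β / l)) (tend _ _ _) ?_ ?_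
    · filter_upwards [eventually_gt_atTop 0] with t ht
      have hs : 0 < Real.sqrt (2 * t) := by positivity
      have h1 : 0 ≤ l * t + 1 - β * t := by nlinarith
      have h2 := lower β (β * t) (Real.sqrt (2 * t)) (l * t) _ hβ (by positivity)
        (erfc_ge _ (1 / Real.sqrt (2 * t)) (by positivity) (by positivity))
        (by positivity)
      rw [← add_div, div_pow, Real.sq_sqrt (by positivity)] at h2
      refine le_trans (le_of_eq ?_) (mul_le_mul_of_nonneg_left h2 (by positivity))
      have e : Real.exp (-1 / 2 * Real.log t) = 1 / Real.sqrt t := by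
        rw [Real.sqrt_eq_rpow, Real.rpow_def_of_pos ht, one_div, ← Real.exp_neg]
        congr 1; ring
      have e2 : -l ^ 2 / 2 * t + (Real.log (β / Real.sqrt Real.pi / Real.sqrt 2) - β - 2 * (l - β)
          + (-2) * t⁻¹ + (-1 / 2) * Real.log t)
          = Real.log (β / Real.sqrt Real.pi / Real.sqrt 2) + (-1 / 2) * Real.log t +
            (β ^ 2 * t / 2 + (-((l * t + 1 - β * t + 1) ^ 2 / (2 * t)) + (-β * (l * t + 1)))) := by
        field_simp; ring
      rw [e2, Real.exp_add, Real.exp_add, Real.exp_log hq, e, Real.exp_add, Real.exp_add,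
        Real.sqrt_mul (by norm_num)]
      have := spi
      field_simp
    · filter_upwards [eventually_gt_atTop 0] with t ht
      have h2 := upper2 β l t hβ h ht
      calc _ ≤ (β / 2) * Real.exp (β ^ 2 * t / 2) *
            (2 * Real.exp (-β ^ 2 * t / 2 - l ^ 2 * t / 2) / l) := by gcongr
        _ = (β / l) * (Real.exp (β ^ 2 * t / 2) * Real.exp (-β ^ 2 * t / 2 - l ^ 2 * t / 2)) := by
            field_simp
        _ = _ := by
            rw [← Real.exp_add, Real.exp_add _ (Real.log _), Real.exp_log (by positivity), mul_comm]
            congr 2; ring
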